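/- Let U ∈ R^{n×n} with n ≥ 100 and suppose there is a set K ⊆ [n] with |K| ≥ (1 − 10^{-4}/16)·n such that for all i ∈ K the squared row norm Σ_j U_{ij}² ≤ 10^{-2}, and for all i the squared row norm is at most 1. Then there exists a vector ζ ∈ {−1, 0, +1}^n with at most n/4 zero entries such that for every i ∈ [n], |Σ_{j=1}^n ζ_j U_{ij}| ≤ 1/2. -/

import Mathlib

lemma pc_two_point (Q T a b c d : ℝ) (hQ : 0 < Q) (ha : 0 ≤ a) (hb : 0 ≤ b) (hc : 0 ≤ c)
    (hd : 0 ≤ d) (h1 : a * c ≤ T * Q) (h2 : b * d ≤ T * Q) (h3 : a * d ≤ T) (h4 : b * c ≤ T) :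
    (a + b) * (c + d) ≤ T * (2 + Q + 1 / Q) := by
  have hT : 0 ≤ T := le_trans (mul_nonneg ha hd) h3
  have h5 : (a * d) * (b * c) ≤ T * T := mul_le_mul h3 h4 (by positivity) hT
  rcases hT.eq_or_lt with h | hT
  · subst h; nlinarith
  have key : a * c + b * d ≤ T * (Q + 1 / Q) := by
    have h6 : 0 ≤ (T * Q - a * c) * (T * Q - b * d) := mul_nonneg (by linarith) (by linarith)
    have h7 : (T * Q) * (a * c + b * d) ≤ (T * Q) * (T * (Q + 1 / Q)) := by
      have : (T * Q) * (T * (Q + 1 / Q)) = (T * Q) ^ 2 + T * T := by field_simp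
      rw [this]; nlinarith
    exact le_of_mul_le_mul_left h7 (by positivity)
  nlinarith

lemma pc_tensor (Q : ℝ) (hQ : 0 < Q) : ∀ (n : ℕ) (T : ℝ) (f g : (Fin n → Bool) → ℝ),
    (∀ x, 0 ≤ f x) → (∀ x, 0 ≤ g x) →
    (∀ x y, f x * g y ≤ T * ∏ i, (if x i = y i then Q else 1)) →
    (∑ x, f x) * (∑ y, g y) ≤ T * (2 + Q + 1 / Q) ^ n := by
  intro n
  induction n with
  | zero =>
    intro T f g hf hg h
    simp only [Fintype.sum_unique, pow_zero]
    have := h (@default _ Unique.instInhabited) (@default _ Unique.instInhabited)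
    simpa only [Finset.univ_eq_empty, Finset.prod_empty] using this
  | succ n ih =>
    intro T f g hf hg h
    have split : ∀ F : (Fin (n+1) → Bool) → ℝ, ∑ x, F x =
        ∑ x : Fin n → Bool, F (Fin.cons true x) + ∑ x : Fin n → Bool, F (Fin.cons false x) := by
      intro F
      rw [← (Fin.consEquiv (fun _ : Fin (n+1) => Bool)).sum_comp, Fintype.sum_prod_type]
      simp [Fin.consEquiv]
    have step : ∀ a b : Bool, (∑ x : Fin n → Bool, f (Fin.cons a x)) *
        (∑ x : Fin n → Bool, g (Fin.cons b x)) ≤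
        (T * (if a = b then Q else 1)) * (2 + Q + 1 / Q) ^ n := by
      intro a b
      apply ih
      · intro x; exact hf _
      · intro x; exact hg _
      · intro x y
        have := h (Fin.cons a x) (Fin.cons b y)
        rw [Fin.prod_univ_succ] at this
        simpa [mul_assoc] using this
    rw [split f, split g]
    have := pc_two_point Q (T * (2 + Q + 1 / Q) ^ n) _ _ _ _ hQ
      (Finset.sum_nonneg fun x _ => hf (Fin.cons true x))
      (Finset.sum_nonneg fun x _ => hf (Fin.cons false x))
      (Finset.sum_nonneg fun x _ => hg (Fin.cons true x))
      (Finset.sum_nonneg fun x _ => hg (Fin.cons false x))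
      (by have := step true true; simp at this ⊢; linarith)
      (by have := step false false; simp at this ⊢; linarith)
      (by have := step true false; simp at this ⊢; linarith)
      (by have := step false true; simp at this ⊢; linarith)
    rw [pow_succ]; linarith

/-- Diameter bound. -/
lemma pc_diam (n : ℕ) (A : Finset (Fin n → Bool))
    (h : ∀ x ∈ A, ∀ y ∈ A, (n : ℝ) / 4 ≤ ((Finset.univ.filter fun i => x i = y i).card : ℝ)) :
    (A.card : ℝ) ≤ 2 ^ n * Real.exp (-(n : ℝ) / 32) := by
  have h1 := pc_tensor (Real.exp (1/2)) (Real.exp_pos _) n (Real.exp (-(n:ℝ)/8))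
    (fun x => if x ∈ A then 1 else 0) (fun x => if x ∈ A then 1 else 0)
    (fun x => by split_ifs <;> norm_num) (fun x => by split_ifs <;> norm_num) (by
      intro x y
      by_cases hx : x ∈ A
      · by_cases hy : y ∈ A
        · rw [Finset.prod_ite]
          simp only [hx, hy, if_true, Finset.prod_const, one_pow, mul_one]
          rw [← Real.exp_nat_mul, ← Real.exp_add]
          apply Real.one_le_exp
          have := h x hx y hy
          linarith
        · simp only [hy, if_false, mul_zero]
          exact mul_nonneg (Real.exp_pos _).le (Finset.prod_nonneg fun i _ => by split_ifs <;> positivity)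
      · simp only [hx, if_false, zero_mul]
        exact mul_nonneg (Real.exp_pos _).le (Finset.prod_nonneg fun i _ => by split_ifs <;> positivity))
  simp only [Finset.sum_ite_mem, Finset.univ_inter, Finset.sum_const, nsmul_eq_mul, mul_one] at h1
  have h2 : 2 + Real.exp (1/2) + 1 / Real.exp (1/2) ≤ 4 * Real.exp (1/16) := by
    have e1 := Real.cosh_le_exp_half_sq (1/4)
    have e2 := Real.cosh_two_mul (1/4)
    have e3 := Real.cosh_sq (1/4)
    have e4 := Real.cosh_eq (2 * (1/4))
    have e5 : Real.exp (1/16) = Real.exp ((1/4)^2/2) ^ 2 := by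
      rw [← Real.exp_nat_mul]; norm_num
    have e6 : (0:ℝ) < Real.cosh (1/4) := Real.cosh_pos _
    rw [e5, one_div (Real.exp _), ← Real.exp_neg]
    norm_num at e1 e2 e3 e4 ⊢
    nlinarith
  have h3 : (A.card : ℝ) ^ 2 ≤ (2 ^ n * Real.exp (-(n : ℝ) / 32)) ^ 2 := by
    have h4 : (2 + Real.exp (1/2) + 1 / Real.exp (1/2)) ^ n ≤ (4 * Real.exp (1/16)) ^ n :=
      pow_le_pow_left₀ (by positivity) h2 n
    have h5 : (2 ^ n * Real.exp (-(n : ℝ) / 32)) ^ 2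
        = Real.exp (-(n:ℝ)/8) * (4 * Real.exp (1/16)) ^ n := by
      rw [mul_pow, mul_pow, ← Real.exp_nat_mul, ← Real.exp_nat_mul, ← pow_mul, mul_comm n 2, pow_mul]
      rw [mul_left_comm, ← Real.exp_add]
      norm_num
      ring
    rw [h5, sq]
    exact h1.trans (mul_le_mul_of_nonneg_left h4 (Real.exp_pos _).le)
  exact le_of_sq_le_sq h3 (by positivity)

def pcS (b : Bool) : ℝ := if b then 1 else -1

lemma pc_mgf (n : ℕ) (u : Fin n → ℝ) (l : ℝ) :
    ∑ x : Fin n → Bool, Real.cosh (l * ∑ j, pcS (x j) * u j) ≤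
      2 ^ n * Real.exp (l ^ 2 * (∑ j, u j ^ 2) / 2) := by
  have key : ∀ m : ℝ, ∑ x : Fin n → Bool, Real.exp (m * ∑ j, pcS (x j) * u j) ≤
      2 ^ n * Real.exp (m ^ 2 * (∑ j, u j ^ 2) / 2) := by
    intro m
    have : ∀ x : Fin n → Bool, Real.exp (m * ∑ j, pcS (x j) * u j) =
        ∏ j, Real.exp (m * (pcS (x j) * u j)) := by
      intro x; rw [Finset.mul_sum, Real.exp_sum]
    simp_rw [this]
    rw [← Fintype.prod_sum (fun j b => Real.exp (m * (pcS b * u j)))]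
    have h2 : (2:ℝ) ^ n * Real.exp (m ^ 2 * (∑ j, u j ^ 2) / 2) =
        ∏ j : Fin n, (2 * Real.exp ((m * u j) ^ 2 / 2)) := by
      rw [Finset.prod_mul_distrib, ← Real.exp_sum]
      simp [mul_pow, Finset.mul_sum, Finset.sum_div]
    rw [h2]
    apply Finset.prod_le_prod
    · intro i _; positivity
    · intro i _
      have := Real.cosh_le_exp_half_sq (m * u i)
      rw [Real.cosh_eq] at this
      simp [pcS]
      linarith
  have h1 := key l
  have h2 := key (-l)
  simp_rw [Real.cosh_eq]
  rw [← Finset.sum_div, Finset.sum_add_distrib]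
  simp only [neg_mul, neg_sq] at h2
  linarith

lemma pc_round (y k : ℝ) (hk : 1 ≤ k) :
    ((round y).natAbs : ℝ) ≤ 2 * Real.exp (-k) * Real.cosh (2 * k * y) := by
  have hab : ((round y).natAbs : ℝ) = |(round y : ℝ)| := by
    rw [Nat.cast_natAbs]; simp
  by_cases h0 : round y = 0
  · rw [h0]; simp; have := Real.cosh_pos (2 * k * y); positivity
  have h1 : (1:ℝ) ≤ |(round y : ℝ)| := by
    have := Int.one_le_abs h0
    exact_mod_cast this
  have h2 : |(round y : ℝ)| ≤ |y| + 1/2 := by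
    have := abs_sub_round y
    have h3 := abs_sub_abs_le_abs_sub (round y : ℝ) y
    rw [abs_sub_comm] at h3
    linarith
  have h3 : 2 * |y| ≤ Real.exp (2 * |y| - 1) := by
    have := Real.add_one_le_exp (2 * |y| - 1); linarith
  have h4 : Real.exp (2 * |y| - 1) ≤ Real.exp (-k + |2 * k * y|) := by
    apply Real.exp_le_exp.2
    rw [abs_mul, abs_of_pos (by linarith : 0 < 2 * k)]
    nlinarith
  have h5 : Real.exp |2 * k * y| ≤ 2 * Real.cosh (2 * k * y) := by
    rw [← Real.cosh_abs, Real.cosh_eq]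
    have := Real.exp_pos (-|2 * k * y|)
    linarith
  rw [Real.exp_add] at h4
  have h6 := mul_le_mul_of_nonneg_left h5 (Real.exp_pos (-k)).le
  rw [hab]; linarith

lemma pc_row (n : ℕ) (u : Fin n → ℝ) (k s : ℝ) (hk : 1 ≤ k) (hs : ∑ j, u j ^ 2 ≤ s) :
    ∑ x : Fin n → Bool, ((round (∑ j, pcS (x j) * u j)).natAbs : ℝ) ≤
      2 ^ n * (2 * Real.exp (-k + 2 * k ^ 2 * s)) := by
  calc _ ≤ ∑ x : Fin n → Bool, 2 * Real.exp (-k) * Real.cosh (2 * k * ∑ j, pcS (x j) * u j) :=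
        Finset.sum_le_sum fun x _ => pc_round _ k hk
    _ = 2 * Real.exp (-k) * ∑ x : Fin n → Bool, Real.cosh (2 * k * ∑ j, pcS (x j) * u j) := by
        rw [Finset.mul_sum]
    _ ≤ 2 * Real.exp (-k) * (2 ^ n * Real.exp ((2 * k) ^ 2 * s / 2)) := by
        refine mul_le_mul_of_nonneg_left ((pc_mgf n u (2 * k)).trans ?_) (by positivity)
        gcongr
    _ = _ := by
        rw [Real.exp_add, show (2 * k) ^ 2 * s / 2 = 2 * k ^ 2 * s by ring]; ring

lemma pc_geom (t : ℝ) (h0 : 0 ≤ t) (h1 : t < 1) (S : Finset ℤ) :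
    ∑ k ∈ S, t ^ k.natAbs ≤ (1 + t) / (1 - t) := by
  have a := hasSum_geometric_of_lt_one h0 h1
  have b : HasSum (fun n : ℕ => t ^ (n + 1)) (t * (1 - t)⁻¹) := by
    simpa [pow_succ'] using a.mul_left t
  have c : HasSum (fun k : ℤ => t ^ k.natAbs) ((1 - t)⁻¹ + t * (1 - t)⁻¹) := by
    apply HasSum.of_nat_of_neg_add_one
    · simpa using a
    · convert b using 2 with n
      congr 1
  have := sum_le_hasSum S (fun k _ => by positivity) c
  calc _ ≤ _ := this
    _ = _ := by ring

lemma pc_count (n : ℕ) (t M : ℝ) (h0 : 0 < t) (h1 : t < 1) (I : Finset (Fin n → ℤ))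
    (hI : ∀ b ∈ I, ((∑ i, (b i).natAbs : ℕ) : ℝ) ≤ M) :
    (I.card : ℝ) * t ^ M ≤ ((1 + t) / (1 - t)) ^ n := by
  calc (I.card : ℝ) * t ^ M = ∑ b ∈ I, t ^ M := by simp
    _ ≤ ∑ b ∈ I, ∏ i, t ^ (b i).natAbs := by
        apply Finset.sum_le_sum
        intro b hb
        rw [Finset.prod_pow_eq_pow_sum, ← Real.rpow_natCast]
        exact Real.rpow_le_rpow_of_exponent_ge h0 h1.le (hI b hb)
    _ ≤ ∑ b ∈ Fintype.piFinset (fun i => I.image (fun b => b i)), ∏ i, t ^ (b i).natAbs := by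
        apply Finset.sum_le_sum_of_subset_of_nonneg
        · intro b hb
          simp only [Fintype.mem_piFinset]
          intro i
          exact Finset.mem_image_of_mem (fun b : Fin n → ℤ => b i) hb
        · intros; positivity
    _ = ∏ i : Fin n, ∑ k ∈ I.image (fun b => b i), t ^ k.natAbs :=
        (Finset.prod_univ_sum (fun i => I.image (fun b => b i)) (fun _ k => t ^ k.natAbs)).symm
    _ ≤ ∏ i : Fin n, (1 + t) / (1 - t) := by
        apply Finset.prod_le_prod
        · intros; positivity
        · intros; exact pc_geom t h0.le h1 _
    _ = _ := by rw [Finset.prod_const, Finset.card_univ, Fintype.card_fin]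

lemma pc_total {n : ℕ} (U : Matrix (Fin n) (Fin n) ℝ)
    (K : Finset (Fin n)) (hK : (1 - (10:ℝ)^(-4:ℤ)/16) * n ≤ K.card)
    (hrowK : ∀ i ∈ K, ∑ j, U i j ^ 2 ≤ (10:ℝ)^(-2:ℤ))
    (hrow : ∀ i, ∑ j, U i j ^ 2 ≤ 1) :
    ∑ x : Fin n → Bool, ∑ i, ((round (∑ j, pcS (x j) * U i j)).natAbs : ℝ) ≤
      2 ^ n * (n / 10000) := by
  have hgood : 2 * Real.exp (-20 + 2 * 20 ^ 2 * (10:ℝ)^(-2:ℤ)) ≤ 1 / 20000 := by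
    have e : (-20 + 2 * 20 ^ 2 * (10:ℝ)^(-2:ℤ)) = -((12:ℕ) * 1) := by norm_num
    rw [e, Real.exp_neg, Real.exp_nat_mul]
    have : (2.7:ℝ) ^ 12 ≤ Real.exp 1 ^ 12 :=
      pow_le_pow_left₀ (by norm_num) (by linarith [Real.exp_one_gt_d9]) 12
    have h2 : (Real.exp 1 ^ 12)⁻¹ ≤ ((2.7:ℝ) ^ 12)⁻¹ := inv_anti₀ (by positivity) this
    refine (mul_le_mul_of_nonneg_left h2 (by norm_num)).trans ?_
    norm_num
  have hbad : 2 * Real.exp (-1 + 2 * 1 ^ 2 * 1) ≤ 8 := by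
    have e : ((-1:ℝ) + 2 * 1 ^ 2 * 1) = 1 := by norm_num
    rw [e]; linarith [Real.exp_one_lt_d9]
  have hKc : ((Kᶜ).card : ℝ) ≤ n / 160000 := by
    have h1 : K.card + (Kᶜ).card = n := by simpa using Finset.card_add_card_compl K
    have h2 : (K.card : ℝ) + ((Kᶜ).card : ℝ) = n := by exact_mod_cast h1
    norm_num at hK
    linarith
  have hKn : (K.card : ℝ) ≤ n := by
    have := Finset.card_le_univ K
    rw [Fintype.card_fin] at this
    exact_mod_cast this
  rw [Finset.sum_comm, ← Finset.sum_add_sum_compl K]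
  have g1 : ∑ i ∈ K, ∑ x : Fin n → Bool, ((round (∑ j, pcS (x j) * U i j)).natAbs : ℝ) ≤
      K.card * (2 ^ n * (1 / 20000)) := by
    rw [← nsmul_eq_mul]
    apply Finset.sum_le_card_nsmul
    intro i hi
    refine (pc_row n (U i) 20 _ (by norm_num) (hrowK i hi)).trans ?_
    gcongr
  have g2 : ∑ i ∈ Kᶜ, ∑ x : Fin n → Bool, ((round (∑ j, pcS (x j) * U i j)).natAbs : ℝ) ≤
      (Kᶜ).card * (2 ^ n * 8) := by
    rw [← nsmul_eq_mul]
    apply Finset.sum_le_card_nsmul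
    intro i hi
    refine (pc_row n (U i) 1 _ (by norm_num) (hrow i)).trans ?_
    gcongr
  have hp : (0:ℝ) < 2 ^ n := by positivity
  have g3 := mul_le_mul_of_nonneg_right hKn (by positivity : (0:ℝ) ≤ 2 ^ n * (1/20000))
  have g4 := mul_le_mul_of_nonneg_right hKc (by positivity : (0:ℝ) ≤ 2 ^ n * 8)
  linarith

lemma pc_num {n : ℕ} (hn : 100 ≤ n) (N : ℝ)
    (hN : N * (Real.exp (-5)) ^ ((n:ℝ) / 5000) ≤
      ((1 + Real.exp (-5)) / (1 - Real.exp (-5))) ^ n) :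
    N * Real.exp (-(n:ℝ)/32) < 1 / 2 := by
  have ht : Real.exp (-5) ≤ 1 / 128 := by
    have e : (-5 : ℝ) = -((5:ℕ) * 1) := by norm_num
    rw [e, Real.exp_neg, Real.exp_nat_mul]
    have : (2.7:ℝ) ^ 5 ≤ Real.exp 1 ^ 5 :=
      pow_le_pow_left₀ (by norm_num) (by linarith [Real.exp_one_gt_d9]) 5
    refine (inv_anti₀ (by positivity) this).trans ?_
    norm_num
  have hR : (1 + Real.exp (-5)) / (1 - Real.exp (-5)) ≤ Real.exp (1/60) := by
    have h1 : (1:ℝ)/60 + 1 ≤ Real.exp (1/60) := Real.add_one_le_exp _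
    refine le_trans ?_ h1
    rw [div_le_iff₀ (by linarith)]
    linarith
  have hRn : ((1 + Real.exp (-5)) / (1 - Real.exp (-5))) ^ n ≤ Real.exp (n / 60) := by
    refine (pow_le_pow_left₀ (div_nonneg (by positivity) (by linarith)) hR n).trans ?_
    rw [← Real.exp_nat_mul]
    apply le_of_eq; congr 1; ring
  have h2 : N * Real.exp (-(n:ℝ)/1000) ≤ Real.exp (n/60) := by
    rw [← Real.exp_mul] at hN
    have : (-5 : ℝ) * (n / 5000) = -(n:ℝ)/1000 := by ring
    rw [this] at hN
    exact hN.trans hRn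
  have hn' : (100:ℝ) ≤ n := by exact_mod_cast hn
  calc N * Real.exp (-(n:ℝ)/32)
      = (N * Real.exp (-(n:ℝ)/1000)) * Real.exp ((n:ℝ)/1000 - n/32) := by
        rw [mul_assoc, ← Real.exp_add]; congr 2; ring
    _ ≤ Real.exp (n/60) * Real.exp ((n:ℝ)/1000 - n/32) := by gcongr
    _ = Real.exp ((n:ℝ)/60 + (n/1000 - n/32)) := by rw [Real.exp_add]
    _ < Real.exp (-Real.log 2) := by
        apply Real.exp_lt_exp.2
        have := Real.log_two_lt_d9
        linarith
    _ = 1 / 2 := by rw [Real.exp_neg, Real.exp_log (by norm_num)]; norm_num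

theorem stmt_6 {n : ℕ} (hn : 100 ≤ n) (U : Matrix (Fin n) (Fin n) ℝ)
    (K : Finset (Fin n)) (hK : (1 - (10:ℝ)^(-4:ℤ)/16) * n ≤ K.card)
    (hrowK : ∀ i ∈ K, ∑ j, U i j ^ 2 ≤ (10:ℝ)^(-2:ℤ))
    (hrow : ∀ i, ∑ j, U i j ^ 2 ≤ 1) :
    ∃ ζ : Fin n → ℝ, (∀ i, ζ i = -1 ∨ ζ i = 0 ∨ ζ i = 1) ∧
      ({i : Fin n | ζ i = 0}.ncard : ℝ) ≤ (n : ℝ) / 4 ∧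
      ∀ i, |∑ j, ζ j * U i j| ≤ 1/2 := by
  by_contra hcon
  have hn' : (100:ℝ) ≤ n := by exact_mod_cast hn
  set b : (Fin n → Bool) → Fin n → ℤ := fun x i => round (∑ j, pcS (x j) * U i j) with hb
  set w : (Fin n → Bool) → ℝ := fun x => ((∑ i, (b x i).natAbs : ℕ) : ℝ) with hw
  have htot : ∑ x, w x ≤ 2 ^ n * (n / 10000) := by
    have := pc_total U K hK hrowK hrow
    simpa [hw, hb] using this
  have hfib : ∀ x y, b x = b y →
      (n : ℝ) / 4 ≤ ((Finset.univ.filter fun i => x i = y i).card : ℝ) := by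
    intro x y hxy
    by_contra hlt
    push Not at hlt
    apply hcon
    refine ⟨fun j => (pcS (x j) - pcS (y j)) / 2, ?_, ?_, ?_⟩
    · intro i
      show (pcS (x i) - pcS (y i)) / 2 = -1 ∨ (pcS (x i) - pcS (y i)) / 2 = 0 ∨
        (pcS (x i) - pcS (y i)) / 2 = 1
      cases x i <;> cases y i <;> norm_num [pcS]
    · have : {i : Fin n | (pcS (x i) - pcS (y i)) / 2 = 0} =
          ((Finset.univ.filter fun i => x i = y i : Finset (Fin n)) : Set (Fin n)) := by
        ext i
        simp only [Set.mem_ofPred_eq, Finset.coe_filter, Finset.mem_univ, true_and]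
        cases x i <;> cases y i <;> norm_num [pcS]
      rw [this, Set.ncard_coe_finset]
      exact hlt.le
    · intro i
      have h1 := abs_le.1 (abs_sub_round (∑ j, pcS (x j) * U i j))
      have h2 := abs_le.1 (abs_sub_round (∑ j, pcS (y j) * U i j))
      have h3 : round (∑ j, pcS (x j) * U i j) = round (∑ j, pcS (y j) * U i j) := congrFun hxy i
      rw [h3] at h1
      have h4 : ∑ j, (pcS (x j) - pcS (y j)) / 2 * U i j =
          ((∑ j, pcS (x j) * U i j) - ∑ j, pcS (y j) * U i j) / 2 := by
        rw [← Finset.sum_sub_distrib, Finset.sum_div]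
        exact Finset.sum_congr rfl fun j _ => by ring
      rw [h4, abs_le]
      constructor <;> linarith [h1.1, h1.2, h2.1, h2.2]
  set G : Finset (Fin n → Bool) := Finset.univ.filter fun x => w x ≤ n / 5000 with hG
  have hGcard : (2:ℝ) ^ n / 2 ≤ G.card := by
    have h1 : (G.card : ℝ) + ((Gᶜ).card : ℝ) = 2 ^ n := by
      have : G.card + (Gᶜ).card = 2 ^ n := by simpa using Finset.card_add_card_compl G
      exact_mod_cast this
    have h2 : ((Gᶜ).card : ℝ) * (n / 5000) ≤ ∑ x, w x := by
      rw [← nsmul_eq_mul]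
      refine (Finset.card_nsmul_le_sum Gᶜ w _ ?_).trans
        (Finset.sum_le_sum_of_subset_of_nonneg (Finset.subset_univ _) fun x _ _ => Nat.cast_nonneg _)
      intro x hx
      simp only [hG, Finset.mem_compl, Finset.mem_filter, Finset.mem_univ, true_and, not_le] at hx
      exact hx.le
    have h3 : ((Gᶜ).card : ℝ) * (n / 5000) ≤ (2 ^ n / 2) * (n / 5000) := by linarith
    have h4 := le_of_mul_le_mul_right h3 (by positivity)
    linarith
  have hcount := pc_count n (Real.exp (-5)) (n / 5000) (Real.exp_pos _)
    (by rw [Real.exp_lt_one_iff]; norm_num) (G.image b) (by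
      intro c hc
      obtain ⟨x, hx, rfl⟩ := Finset.mem_image.1 hc
      exact (Finset.mem_filter.1 hx).2)
  have hnum := pc_num hn _ hcount
  have hsum : (G.card : ℝ) ≤ (G.image b).card * (2 ^ n * Real.exp (-(n:ℝ)/32)) := by
    rw [Finset.card_eq_sum_card_image b G, Nat.cast_sum, ← nsmul_eq_mul]
    apply Finset.sum_le_card_nsmul
    intro c _
    apply pc_diam
    intro x hx y hy
    exact hfib x y ((Finset.mem_filter.1 hx).2.trans (Finset.mem_filter.1 hy).2.symm)
  have hp : (0:ℝ) < 2 ^ n := by positivity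
  have := mul_lt_mul_of_pos_left hnum hp
  linarith
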